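/- arXiv:2409.00307 — 3 statements merged into one kernel-verified Lean document; each statement's English description precedes it below -/
import Mathlib

section
/- Let α > 0, let G_α be the kernel G_α(y′,y) = −(α sinh α)^{−1} sinh(α(y−1)) sinh(α(y′+1)) for y′ ≤ y and −(α sinh α)^{−1} sinh(α(y′−1)) sinh(α(y+1)) for y ≤ y′, set b₁ = −1/2, b₂ = 0, b₃ = 1/2, and let χ : ℝ → ℝ be continuous, nonnegative, supported in [−1,1], with ∫χ = 1. For μ > 0 small and k = 1,2,3 define A_k^±(μ) = μ^{−1} ∫_{−1}^{1} χ((z − b_k)/μ) ∂_yG_α(z, ±1) dz. Then: (i) A_k^±(μ) → ∂_yG_α(b_k, ±1) as μ → 0⁺; (ii) for all sufficiently small μ, the 2×2 linear system a₁(μ) A₁^+(μ) + (sinh α)^{−1} A₂^+(μ) + a₃(μ) A₃^+(μ) = 0, a₁(μ) A₁^−(μ) + (sinh α)^{−1} A₂^−(μ) + a₃(μ) A₃^−(μ) = 0 has a unique solution (a₁(μ), a₃(μ)); (iii) (a₁(μ), a₃(μ)) → (a₁, a₃) as μ → 0⁺, where a₁ = a₃ = −(sinh(α/2) + sinh(3α/2))^{−1}.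 -/
/-!
Statement 8: the mollified boundary system — convergence of the coefficients
`A_k^±(μ)` and solvability of the 2×2 system for small `μ`.
-/

noncomputable section

open Set Filter Topology MeasureTheory intervalIntegral

/-- The Dirichlet kernel for `∂_y² − α²` on `[−1,1]`. -/
def greenG (α y' y : ℝ) : ℝ :=
  if y' ≤ y then
    -(Real.sinh (α * (y - 1)) * Real.sinh (α * (y' + 1))) / (α * Real.sinh α)
  else
    -(Real.sinh (α * (y' - 1)) * Real.sinh (α * (y + 1))) / (α * Real.sinh α)

/-- `A(α,μ,χ,b,σ) = μ⁻¹ ∫_{−1}^{1} χ((z−b)/μ) ∂_y G_α(z,σ) dz`. -/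
def mollCoef (α μ : ℝ) (χ : ℝ → ℝ) (b σ : ℝ) : ℝ :=
  μ⁻¹ * ∫ z in (-1 : ℝ)..1, χ ((z - b) / μ) * deriv (fun y => greenG α z y) σ

/-- The mollified 2×2 boundary system for the unknowns `(a₁, a₃)`, with
`a₂ = (sinh α)⁻¹` fixed. -/
def mollSystem (α μ : ℝ) (χ : ℝ → ℝ) (a₁ a₃ : ℝ) : Prop :=
  (a₁ * mollCoef α μ χ (-(1 / 2)) 1 + (Real.sinh α)⁻¹ * mollCoef α μ χ 0 1
      + a₃ * mollCoef α μ χ (1 / 2) 1 = 0) ∧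
  (a₁ * mollCoef α μ χ (-(1 / 2)) (-1) + (Real.sinh α)⁻¹ * mollCoef α μ χ 0 (-1)
      + a₃ * mollCoef α μ χ (1 / 2) (-1) = 0)

/-- The normal derivative of the kernel at the upper boundary point. -/
lemma deriv_greenG_one {α z : ℝ} (hα : 0 < α) (hz : z < 1) :
    deriv (fun y => greenG α z y) 1 = -Real.sinh (α * (z + 1)) / Real.sinh α := by
  have hS : Real.sinh α ≠ 0 := (Real.sinh_pos_iff.2 hα).ne'
  have heq : (fun y => greenG α z y) =ᶠ[𝓝 1] fun y =>
      -(Real.sinh (α * (y - 1)) * Real.sinh (α * (z + 1))) / (α * Real.sinh α) := by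
    filter_upwards [Ioi_mem_nhds hz] with y hy
    simp [greenG, (mem_Ioi.1 hy).le]
  rw [heq.deriv_eq]
  have hinner : HasDerivAt (fun y : ℝ => α * (y - 1)) (α * 1) 1 :=
    ((hasDerivAt_id (1 : ℝ)).sub_const 1).const_mul α
  have hderiv := (((hinner.sinh).mul_const (Real.sinh (α * (z + 1)))).neg).div_const
    (α * Real.sinh α)
  refine hderiv.deriv.trans ?_
  simp
  field_simp

/-- The normal derivative of the kernel at the lower boundary point. -/
lemma deriv_greenG_neg_one {α z : ℝ} (hα : 0 < α) (hz : -1 < z) :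
    deriv (fun y => greenG α z y) (-1) = -Real.sinh (α * (z - 1)) / Real.sinh α := by
  have hS : Real.sinh α ≠ 0 := (Real.sinh_pos_iff.2 hα).ne'
  have heq : (fun y => greenG α z y) =ᶠ[𝓝 (-1)] fun y =>
      -(Real.sinh (α * (z - 1)) * Real.sinh (α * (y + 1))) / (α * Real.sinh α) := by
    filter_upwards [Iio_mem_nhds hz] with y hy
    simp [greenG, not_le.2 (mem_Iio.1 hy)]
  rw [heq.deriv_eq]
  have hinner : HasDerivAt (fun y : ℝ => α * (y + 1)) (α * 1) (-1) :=
    ((hasDerivAt_id (-1 : ℝ)).add_const 1).const_mul α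
  have hderiv := (((hinner.sinh).const_mul (Real.sinh (α * (z - 1)))).neg).div_const
    (α * Real.sinh α)
  refine hderiv.deriv.trans ?_
  simp
  field_simp

/-- An interval containing `[-1, 1]` carries the full integral of a function vanishing off
`[-1, 1]`. -/
lemma intervalIntegral_eq_integral_of_eq_zero_off {f : ℝ → ℝ}
    (hf : ∀ x, x ∉ Icc (-1 : ℝ) 1 → f x = 0) {l r : ℝ} (hl : l ≤ -1) (hr : 1 ≤ r) :
    ∫ x in l..r, f x = ∫ x, f x := by
  rw [integral_of_le (by linarith), ← integral_Icc_eq_integral_Ioc]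
  refine setIntegral_eq_integral_of_forall_compl_eq_zero fun x hx => hf x fun h => hx ?_
  exact ⟨hl.trans h.1, h.2.trans hr⟩

/-- Averages against a compactly supported mollifier concentrated at an interior point `b`
converge to the value at `b`. -/
lemma tendsto_mollified_integral {χ g : ℝ → ℝ} (hχc : Continuous χ) (hg : Continuous g)
    (hχsupp : ∀ x, x ∉ Icc (-1 : ℝ) 1 → χ x = 0) (hχint : ∫ x : ℝ, χ x = 1)
    {b : ℝ} (hb : b ∈ Ioo (-1 : ℝ) 1) :
    Tendsto (fun μ : ℝ => μ⁻¹ * ∫ z in (-1 : ℝ)..1, χ ((z - b) / μ) * g z) (𝓝[>] 0)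
      (𝓝 (g b)) := by
  have hcont : Continuous fun μ : ℝ => ∫ x in (-1 : ℝ)..1, χ x * g (b + μ * x) :=
    continuous_parametric_intervalIntegral_of_continuous' (by fun_prop) _ _
  have hlim : Tendsto (fun μ : ℝ => ∫ x in (-1 : ℝ)..1, χ x * g (b + μ * x)) (𝓝[>] 0)
      (𝓝 (g b)) := by
    have h := (hcont.tendsto 0).mono_left (nhdsWithin_le_nhds (s := Ioi 0))
    simpa [intervalIntegral_eq_integral_of_eq_zero_off hχsupp le_rfl le_rfl, hχint] using h
  refine hlim.congr' ?_
  have hδ : 0 < min (1 + b) (1 - b) := lt_min (by linarith [hb.1]) (by linarith [hb.2])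
  filter_upwards [Ioo_mem_nhdsGT hδ] with μ hμ
  have hμ0 : 0 < μ := hμ.1
  have h₁ : μ < 1 + b := hμ.2.trans_le (min_le_left _ _)
  have h₂ : μ < 1 - b := hμ.2.trans_le (min_le_right _ _)
  have hzero : ∀ x, x ∉ Icc (-1 : ℝ) 1 → χ x * g (b + μ * x) = 0 := fun x hx => by
    rw [hχsupp x hx, zero_mul]
  have hsubst : ∫ z in (-1 : ℝ)..1, χ ((z - b) / μ) * g z
      = ∫ z in (-1 : ℝ)..1, (fun x => χ x * g (b + μ * x)) (z / μ - b / μ) := by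
    refine integral_congr fun z _ => ?_
    have hz : b + μ * (z / μ - b / μ) = z := by field_simp; ring
    simp only [hz, sub_div]
  rw [hsubst, integral_comp_div_sub (fun x => χ x * g (b + μ * x)) hμ0.ne', smul_eq_mul,
    inv_mul_cancel_left₀ hμ0.ne',
    intervalIntegral_eq_integral_of_eq_zero_off hzero le_rfl le_rfl,
    intervalIntegral_eq_integral_of_eq_zero_off hzero]
  · rw [← sub_div, div_le_iff₀ hμ0]; linarith
  · rw [← sub_div, le_div_iff₀ hμ0]; linarith

/-- The mollified coefficients converge once the boundary derivative of the kernel is a continuous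
function of the interior source point. -/
lemma tendsto_mollCoef {α σ : ℝ} {χ g : ℝ → ℝ} (hχc : Continuous χ) (hg : Continuous g)
    (hχsupp : ∀ x, x ∉ Icc (-1 : ℝ) 1 → χ x = 0) (hχint : ∫ x : ℝ, χ x = 1)
    (hderiv : ∀ z ∈ Ioo (-1 : ℝ) 1, deriv (fun y => greenG α z y) σ = g z)
    {b : ℝ} (hb : b ∈ Ioo (-1 : ℝ) 1) :
    Tendsto (fun μ => mollCoef α μ χ b σ) (𝓝[>] 0) (𝓝 (g b)) := by
  refine (tendsto_mollified_integral hχc hg hχsupp hχint hb).congr fun μ => ?_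
  unfold mollCoef
  congr 1
  simp only [integral_of_le (show (-1 : ℝ) ≤ 1 by norm_num), integral_Ioc_eq_integral_Ioo]
  refine setIntegral_congr_fun measurableSet_Ioo fun z hz => ?_
  simp only [hderiv z hz]

/-- Cramer's rule for two equations in two unknowns. -/
lemma cramer_two {A B C D e f : ℝ} (h : A * D - B * C ≠ 0) (p q : ℝ) :
    (p * A + e + q * B = 0 ∧ p * C + f + q * D = 0) ↔
      p = (f * B - e * D) / (A * D - B * C) ∧ q = (e * C - f * A) / (A * D - B * C) := by
  rw [eq_div_iff h, eq_div_iff h]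
  constructor
  · rintro ⟨h₁, h₂⟩
    exact ⟨by linear_combination D * h₁ - B * h₂, by linear_combination A * h₂ - C * h₁⟩
  · rintro ⟨hp, hq⟩
    constructor
    · refine mul_left_cancel₀ h ?_
      linear_combination A * hp + B * hq
    · refine mul_left_cancel₀ h ?_
      linear_combination C * hp + D * hq

theorem mollified_boundary_system (α : ℝ) (hα : 0 < α)
    (χ : ℝ → ℝ) (hχc : Continuous χ) (hχ0 : ∀ x, 0 ≤ χ x)
    (hχsupp : ∀ x, x ∉ Icc (-1 : ℝ) 1 → χ x = 0)
    (hχint : ∫ x : ℝ, χ x = 1) :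
    -- (i) convergence of the coefficients as `μ → 0⁺`
    (∀ b ∈ ({-(1 / 2), 0, 1 / 2} : Set ℝ), ∀ σ ∈ ({-1, 1} : Set ℝ),
      Tendsto (fun μ => mollCoef α μ χ b σ) (𝓝[>] 0)
        (𝓝 (deriv (fun y => greenG α b y) σ))) ∧
    -- (ii) unique solvability for small `μ`, and (iii) convergence of the solutions
    (∃ μ₀ > (0 : ℝ), ∃ a₁ a₃ : ℝ → ℝ,
      (∀ μ ∈ Ioo (0 : ℝ) μ₀,
        mollSystem α μ χ (a₁ μ) (a₃ μ) ∧
        ∀ p q : ℝ, mollSystem α μ χ p q → p = a₁ μ ∧ q = a₃ μ) ∧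
      Tendsto a₁ (𝓝[>] 0) (𝓝 (-(Real.sinh (α / 2) + Real.sinh (3 * α / 2))⁻¹)) ∧
      Tendsto a₃ (𝓝[>] 0) (𝓝 (-(Real.sinh (α / 2) + Real.sinh (3 * α / 2))⁻¹))) := by
  have hS : 0 < Real.sinh α := Real.sinh_pos_iff.2 hα
  have hplus {b : ℝ} (hb : b ∈ Ioo (-1 : ℝ) 1) : Tendsto (fun μ => mollCoef α μ χ b 1) (𝓝[>] 0)
      (𝓝 (-Real.sinh (α * (b + 1)) / Real.sinh α)) :=
    tendsto_mollCoef (g := fun z => -Real.sinh (α * (z + 1)) / Real.sinh α) hχc (by fun_prop)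
      hχsupp hχint (fun z hz => deriv_greenG_one hα hz.2) hb
  have hminus {b : ℝ} (hb : b ∈ Ioo (-1 : ℝ) 1) :
      Tendsto (fun μ => mollCoef α μ χ b (-1)) (𝓝[>] 0)
        (𝓝 (-Real.sinh (α * (b - 1)) / Real.sinh α)) :=
    tendsto_mollCoef (g := fun z => -Real.sinh (α * (z - 1)) / Real.sinh α) hχc (by fun_prop)
      hχsupp hχint (fun z hz => deriv_greenG_neg_one hα hz.1) hb
  refine ⟨?_, ?_⟩
  · intro b hb σ hσ
    have hb' : b ∈ Ioo (-1 : ℝ) 1 := by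
      rcases hb with rfl | rfl | rfl <;> constructor <;> norm_num
    rcases hσ with rfl | rfl
    · rw [deriv_greenG_neg_one hα hb'.1]
      exact hminus hb'
    · rw [deriv_greenG_one hα hb'.2]
      exact hplus hb'
  set S := Real.sinh α with hSdef
  set s := Real.sinh (α / 2) with hsdef
  set t := Real.sinh (3 * α / 2) with htdef
  have hs : 0 < s := Real.sinh_pos_iff.2 (by linarith)
  have hst : s < t := Real.sinh_lt_sinh.2 (by linarith)
  have hA : Tendsto (fun μ => mollCoef α μ χ (-(1 / 2)) 1) (𝓝[>] 0) (𝓝 (-s / S)) := by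
    convert hplus (b := -(1 / 2)) (by constructor <;> norm_num) using 4
    rw [hsdef]; congr 1; ring
  have hB : Tendsto (fun μ => mollCoef α μ χ (1 / 2) 1) (𝓝[>] 0) (𝓝 (-t / S)) := by
    convert hplus (b := 1 / 2) (by constructor <;> norm_num) using 4
    rw [htdef]; congr 1; ring
  have hC : Tendsto (fun μ => mollCoef α μ χ (-(1 / 2)) (-1)) (𝓝[>] 0) (𝓝 (t / S)) := by
    convert hminus (b := -(1 / 2)) (by constructor <;> norm_num) using 3
    rw [htdef, ← Real.sinh_neg]; congr 1; ring
  have hD : Tendsto (fun μ => mollCoef α μ χ (1 / 2) (-1)) (𝓝[>] 0) (𝓝 (s / S)) := by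
    convert hminus (b := 1 / 2) (by constructor <;> norm_num) using 3
    rw [hsdef, ← Real.sinh_neg]; congr 1; ring
  have hE : Tendsto (fun μ => S⁻¹ * mollCoef α μ χ 0 1) (𝓝[>] 0) (𝓝 (-S⁻¹)) := by
    convert (hplus (b := 0) (by constructor <;> norm_num)).const_mul S⁻¹ using 2
    rw [zero_add, mul_one, ← hSdef]; field_simp
  have hF : Tendsto (fun μ => S⁻¹ * mollCoef α μ χ 0 (-1)) (𝓝[>] 0) (𝓝 S⁻¹) := by
    convert (hminus (b := 0) (by constructor <;> norm_num)).const_mul S⁻¹ using 2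
    rw [zero_sub, mul_neg_one, Real.sinh_neg, ← hSdef]; field_simp
  have hts : t - s ≠ 0 := (sub_pos.2 hst).ne'
  have hsum : s + t ≠ 0 := by linarith
  have hdet : -s / S * (s / S) - -t / S * (t / S) = (t - s) * (s + t) / S ^ 2 := by
    field_simp; ring
  have hdet0 : -s / S * (s / S) - -t / S * (t / S) ≠ 0 := by
    rw [hdet]
    exact div_ne_zero (mul_ne_zero hts hsum) (pow_ne_zero 2 hS.ne')
  have hdetlim := (hA.mul hD).sub (hB.mul hC)
  obtain ⟨μ₀, hμ₀, hsub⟩ := mem_nhdsGT_iff_exists_Ioo_subset.1 (hdetlim.eventually_ne hdet0)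
  refine ⟨μ₀, hμ₀, _, _, fun μ hμ => ⟨(cramer_two (hsub hμ) _ _).2 ⟨rfl, rfl⟩,
    fun p q hpq => (cramer_two (hsub hμ) p q).1 hpq⟩, ?_, ?_⟩
  · convert ((hF.mul hB).sub (hE.mul hD)).div hdetlim hdet0 using 1
    · rfl
    · rw [hdet]; congr 1; field_simp; ring
  · convert ((hE.mul hC).sub (hF.mul hA)).div hdetlim hdet0 using 1
    · rfl
    · rw [hdet]; congr 1; field_simp; ring
end
end

section
/- In the setting of the mollified construction (α > 0, kernel G_α, points b₁ = −1/2, b₂ = 0, b₃ = 1/2, mollifier χ, coefficients a₁(μ), a₂(μ) = (sinh α)^{−1}, a₃(μ) solving the mollified boundary system, and limits a₁ = a₃ = −(sinh(α/2)+sinh(3α/2))^{−1}, a₂ = (sinh α)^{−1}), define D(t,μ) = Σ_{k=1}^{3} a_k(μ) μ^{−1} ∫_{−1}^{1} χ((z − b_k)/μ) ∂_yG_α(z,−1) e^{−iαzt} dz and D(t) = Σ_{k=1}^{3} a_k ∂_yG_α(b_k,−1) e^{−iα b_k t}. Then for every fixed T > 0, sup_{0 ≤ t ≤ T} |D(t,μ)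 − D(t)| → 0 as μ → 0⁺. -/
/-!
Statement 9: uniform-in-time convergence, as `μ → 0⁺`, of the boundary derivative
`D(t,μ) = ∂_yψ₁(t,−1,μ)` of the mollified construction to the Dirac-mass one `D(t)`.
-/

noncomputable section

open Set Filter Topology MeasureTheory intervalIntegral

/-- One mollified term of `D(t,μ)`:
`a · μ⁻¹ ∫ χ((z−b)/μ) ∂_yG_α(z,−1) e^{−iαzt} dz`. -/
def mollTerm (α μ : ℝ) (χ : ℝ → ℝ) (a b t : ℝ) : ℂ :=
  (a * μ⁻¹ : ℝ) * ∫ z in (-1 : ℝ)..1,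
    ((χ ((z - b) / μ) * deriv (fun y => greenG α z y) (-1) : ℝ) : ℂ)
      * Complex.exp (-Complex.I * α * z * t)

/-- `D(t,μ) = ∂_yψ₁(t,−1,μ)` of the mollified vorticity profile. -/
def Dmoll (α μ : ℝ) (χ : ℝ → ℝ) (a₁ a₃ : ℝ) (t : ℝ) : ℂ :=
  mollTerm α μ χ a₁ (-(1 / 2)) t + mollTerm α μ χ (Real.sinh α)⁻¹ 0 t
    + mollTerm α μ χ a₃ (1 / 2) t

/-- One term of the limit `D(t)`: `a ∂_yG_α(b,−1) e^{−iαbt}`. -/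
def diracTerm (α a b t : ℝ) : ℂ :=
  (a * deriv (fun y => greenG α b y) (-1) : ℝ) * Complex.exp (-Complex.I * α * b * t)

/-- `D(t)` of the limiting three-Dirac-mass vorticity. -/
def Dlim (α : ℝ) (t : ℝ) : ℂ :=
  diracTerm α (-(Real.sinh (α / 2) + Real.sinh (3 * α / 2))⁻¹) (-(1 / 2)) t
    + diracTerm α (Real.sinh α)⁻¹ 0 t
    + diracTerm α (-(Real.sinh (α / 2) + Real.sinh (3 * α / 2))⁻¹) (1 / 2) t

/-- The transported boundary kernel `∂_yG_α(z,-1) e^{-iαzt}`, continued smoothly in `z`. -/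
def boundaryKernel (α z t : ℝ) : ℂ :=
  ((-Real.sinh (α * (z - 1)) / Real.sinh α : ℝ) : ℂ) * Complex.exp (-Complex.I * α * z * t)

/-- The average of the boundary kernel against the mollifier, in rescaled variables. -/
def kernelAverage (α : ℝ) (χ : ℝ → ℝ) (b μ t : ℝ) : ℂ :=
  ∫ s in (-2 : ℝ)..2, (χ s : ℂ) * boundaryKernel α (b + μ * s) t

lemma continuous_boundaryKernel (α : ℝ) :
    Continuous fun p : ℝ × ℝ => boundaryKernel α p.1 p.2 := by
  unfold boundaryKernel
  fun_prop

lemma continuous_kernelAverage (α : ℝ) {χ : ℝ → ℝ} (hχc : Continuous χ) (b : ℝ) :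
    Continuous fun p : ℝ × ℝ => kernelAverage α χ b p.1 p.2 := by
  unfold kernelAverage
  refine continuous_parametric_intervalIntegral_of_continuous' ?_ _ _
  refine (Complex.continuous_ofReal.comp (hχc.comp continuous_snd)).mul ?_
  exact (continuous_boundaryKernel α).comp
    (f := fun q : (ℝ × ℝ) × ℝ => (b + q.1.1 * q.2, q.1.2)) (by fun_prop)

lemma kernelAverage_zero (α : ℝ) {χ : ℝ → ℝ}
    (hχsupp : ∀ x, x ∉ Icc (-1 : ℝ) 1 → χ x = 0) (hχint : ∫ x : ℝ, χ x = 1) (b t : ℝ) :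
    kernelAverage α χ b 0 t = boundaryKernel α b t := by
  have h1 : ∫ s in (-2 : ℝ)..2, χ s = 1 := by
    rw [← hχint]
    refine integral_eq_integral_of_support_subset fun x hx => ?_
    have := not_imp_comm.1 (hχsupp x) hx
    exact ⟨by linarith [this.1], by linarith [this.2]⟩
  simp [kernelAverage, intervalIntegral.integral_mul_const, intervalIntegral.integral_ofReal, h1]

lemma mollTerm_eq_mul_kernelAverage {α μ b : ℝ} (hα : 0 < α) {χ : ℝ → ℝ}
    (hχsupp : ∀ x, x ∉ Icc (-1 : ℝ) 1 → χ x = 0) (hμ : 0 < μ) (hμb : |b| + μ < 1) (a t : ℝ) :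
    mollTerm α μ χ a b t = a * kernelAverage α χ b μ t := by
  set f : ℝ → ℂ := fun z => (χ ((z - b) / μ) : ℂ) * boundaryKernel α z t with hf
  have hsupp : ∀ z ∈ Function.support f, b - μ ≤ z ∧ z ≤ b + μ := by
    intro z hz
    have hχz : χ ((z - b) / μ) ≠ 0 := fun h => hz (by simp [hf, h])
    have := not_imp_comm.1 (hχsupp _) hχz
    have h1 := (le_div_iff₀ hμ).1 this.1
    have h2 := (div_le_iff₀ hμ).1 this.2
    constructor <;> linarith
  have hb := abs_le.1 (le_refl |b|)
  have hint : ∫ z in (-1 : ℝ)..1, ((χ ((z - b) / μ) * deriv (fun y => greenG α z y) (-1) : ℝ) : ℂ)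
      * Complex.exp (-Complex.I * α * z * t) = ∫ z in (-1 : ℝ)..1, f z := by
    refine intervalIntegral.integral_congr_ae (ae_of_all _ fun z hz => ?_)
    rw [uIoc_of_le (by norm_num)] at hz
    simp only [hf, boundaryKernel, deriv_greenG_neg_one hα hz.1]
    push_cast
    ring
  have hone : ∫ z in (-1 : ℝ)..1, f z = ∫ z, f z :=
    integral_eq_integral_of_support_subset fun z hz =>
      ⟨by linarith [(hsupp z hz).1], by linarith [(hsupp z hz).2]⟩
  have htwo : ∫ z in (b + μ * -2)..(b + μ * 2), f z = ∫ z, f z :=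
    integral_eq_integral_of_support_subset fun z hz =>
      ⟨by linarith [(hsupp z hz).1], by linarith [(hsupp z hz).2]⟩
  have hscale : kernelAverage α χ b μ t = (μ⁻¹ : ℝ) • ∫ z, f z := by
    rw [← htwo, ← intervalIntegral.integral_comp_add_mul f hμ.ne' b]
    simp [kernelAverage, hf, hμ.ne']
  rw [mollTerm, hint, hone, hscale, Complex.real_smul]
  push_cast
  ring

lemma diracTerm_eq_mul_boundaryKernel {α b : ℝ} (hα : 0 < α) (hb : -1 < b) (a t : ℝ) :
    diracTerm α a b t = a * boundaryKernel α b t := by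
  rw [diracTerm, boundaryKernel, deriv_greenG_neg_one hα hb]
  push_cast
  ring

theorem mollified_boundary_derivative_uniform_convergence
    (α : ℝ) (hα : 0 < α)
    (χ : ℝ → ℝ) (hχc : Continuous χ) (hχ0 : ∀ x, 0 ≤ χ x)
    (hχsupp : ∀ x, x ∉ Icc (-1 : ℝ) 1 → χ x = 0)
    (hχint : ∫ x : ℝ, χ x = 1)
    (μ₀ : ℝ) (hμ₀ : 0 < μ₀) (a₁ a₃ : ℝ → ℝ)
    -- `(a₁(μ), a₃(μ))` solves the mollified boundary system for small `μ`
    (hsol : ∀ μ ∈ Ioo (0 : ℝ) μ₀, mollSystem α μ χ (a₁ μ) (a₃ μ))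
    -- and converges to the Dirac-mass coefficients as `μ → 0⁺`
    (hconv₁ : Tendsto a₁ (𝓝[>] 0) (𝓝 (-(Real.sinh (α / 2) + Real.sinh (3 * α / 2))⁻¹)))
    (hconv₃ : Tendsto a₃ (𝓝[>] 0) (𝓝 (-(Real.sinh (α / 2) + Real.sinh (3 * α / 2))⁻¹))) :
    ∀ T > (0 : ℝ),
      Tendsto (fun μ => ⨆ t : Icc (0 : ℝ) T, ‖Dmoll α μ χ (a₁ μ) (a₃ μ) t - Dlim α t‖)
        (𝓝[>] 0) (𝓝 0) := by
  intro T hT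
  set A := -(Real.sinh (α / 2) + Real.sinh (3 * α / 2))⁻¹
  let Φ : ℝ × ℝ × ℝ → ℝ → ℂ := fun p t =>
    (p.1 : ℂ) * kernelAverage α χ (-(1 / 2)) p.2.2 t
      + ((Real.sinh α)⁻¹ : ℝ) * kernelAverage α χ 0 p.2.2 t
      + (p.2.1 : ℂ) * kernelAverage α χ (1 / 2) p.2.2 t
  have hK : ∀ b, Continuous fun q : (ℝ × ℝ × ℝ) × ℝ => kernelAverage α χ b q.1.2.2 q.2 :=
    fun b => (continuous_kernelAverage α hχc b).comp
      (f := fun q : (ℝ × ℝ × ℝ) × ℝ => (q.1.2.2, q.2)) (by fun_prop)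
  have hΦ : Continuous fun q : (ℝ × ℝ × ℝ) × ℝ => Φ q.1 q.2 := by
    have h1 := hK (-(1 / 2))
    have h2 := hK 0
    have h3 := hK (1 / 2)
    simp only [Φ]
    fun_prop
  have hlim : ∀ t, Dlim α t = Φ (A, A, 0) t := fun t => by
    simp only [Dlim, Φ, kernelAverage_zero α hχsupp hχint]
    rw [diracTerm_eq_mul_boundaryKernel hα (by norm_num),
      diracTerm_eq_mul_boundaryKernel hα (by norm_num),
      diracTerm_eq_mul_boundaryKernel hα (by norm_num)]
  have hsup : Continuous fun p : ℝ × ℝ × ℝ =>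
      sSup ((fun t => ‖Φ p t - Φ (A, A, 0) t‖) '' Icc (0 : ℝ) T) := by
    refine isCompact_Icc.continuous_sSup ?_
    exact (hΦ.sub (hΦ.comp (f := fun q : (ℝ × ℝ × ℝ) × ℝ => ((A, A, (0 : ℝ)), q.2))
      (by fun_prop))).norm
  have hpar : Tendsto (fun μ : ℝ => (a₁ μ, a₃ μ, μ)) (𝓝[>] 0) (𝓝 (A, A, 0)) :=
    hconv₁.prodMk_nhds (hconv₃.prodMk_nhds (tendsto_id.mono_left nhdsWithin_le_nhds))
  have hmain := (hsup.tendsto (A, A, 0)).comp hpar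
  have hzero : sSup ((fun t => ‖Φ (A, A, 0) t - Φ (A, A, 0) t‖) '' Icc (0 : ℝ) T) = 0 := by
    simp [(nonempty_Icc.2 hT.le).image_const]
  rw [hzero] at hmain
  refine hmain.congr' ?_
  filter_upwards [Ioo_mem_nhdsGT (show (0 : ℝ) < 1 / 2 by norm_num)] with μ hμ
  have hmoll : ∀ t, Dmoll α μ χ (a₁ μ) (a₃ μ) t = Φ (a₁ μ, a₃ μ, μ) t := fun t => by
    have hhalf : |(1 / 2 : ℝ)| + μ < 1 := by
      rw [abs_of_pos (by norm_num)]
      linarith [hμ.2]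
    simp only [Dmoll, Φ]
    rw [mollTerm_eq_mul_kernelAverage hα hχsupp hμ.1 (by rwa [abs_neg]),
      mollTerm_eq_mul_kernelAverage hα hχsupp hμ.1 (by rw [abs_zero]; linarith [hμ.2]),
      mollTerm_eq_mul_kernelAverage hα hχsupp hμ.1 hhalf]
  simp only [Function.comp_apply, sSup_image', hmoll, hlim]
end
end

section
/- Let α > 0, C > 0, c₁ > 0, and let q : [0,∞) → ℂ be continuous with |q(Y)| ≤ C e^{−c₁ Y} for all Y ≥ 0. Then for every δ ∈ (0,1) there exists Y₀ ≥ 0 such that the solution ψ₂ of the second-order ODE ψ₂''(Y) = (α² + q(Y)) ψ₂(Y) on [Y₀,∞) with initial data ψ₂(Y₀) = e^{αY₀} and ψ₂'(Y₀) = α e^{αY₀} satisfies |ψ₂(Y) − e^{αY}| ≤ δ e^{αY} for all Y ≥ Y₀. -/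
/-!
Statement 14: the growing solution of `ψ₂'' = (α² + q)ψ₂` normalized at `Y₀` stays
`δ`-close to `e^{αY}` provided `Y₀` is large enough.
-/

noncomputable section

open Set Filter Topology

/-- A solution of `f' = -k f + g` with `k ≥ 0`, zero initial value at `a` and
`‖g t‖ ≤ K * c * exp (-c * t)` is bounded by `K * exp (-c * a)`. -/
theorem norm_le_of_hasDerivWithinAt_damped {f g : ℝ → ℂ} {k K c a T : ℝ}
    (hk : 0 ≤ k) (hK : 0 ≤ K) (hc : 0 < c) (haT : a ≤ T)
    (hf : ∀ t ∈ Ici a, HasDerivWithinAt f (-(k : ℂ) * f t + g t) (Ici a) t)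
    (hg : ∀ t ∈ Icc a T, ‖g t‖ ≤ K * c * Real.exp (-c * t)) (ha : f a = 0) :
    ‖f T‖ ≤ K * Real.exp (-c * a) := by
  have hexp (t : ℝ) : HasDerivAt (fun t : ℝ => Real.exp (k * t)) (Real.exp (k * t) * k) t := by
    simpa using ((hasDerivAt_id t).const_mul k).exp
  have hF : ∀ t ∈ Ici a, HasDerivWithinAt (fun t => ((Real.exp (k * t) : ℝ) : ℂ) * f t)
      ((Real.exp (k * t) : ℝ) * g t) (Ici a) t := by
    intro t ht
    refine ((hexp t).ofReal_comp.hasDerivWithinAt.mul (hf t ht)).congr_deriv ?_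
    push_cast
    ring
  have hB (t : ℝ) : HasDerivAt
      (fun t => Real.exp (k * t) * (K * (Real.exp (-c * a) - Real.exp (-c * t))))
      (Real.exp (k * t) * k * (K * (Real.exp (-c * a) - Real.exp (-c * t))) +
        Real.exp (k * t) * (K * c * Real.exp (-c * t))) t := by
    have h : HasDerivAt (fun t : ℝ => Real.exp (-c * t)) (Real.exp (-c * t) * -c) t := by
      simpa using ((hasDerivAt_id t).const_mul (-c)).exp
    refine ((hexp t).mul ((h.const_sub (Real.exp (-c * a))).const_mul K)).congr_deriv ?_
    ring
  have key := image_norm_le_of_norm_deriv_right_le_deriv_boundary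
    (f := fun t => ((Real.exp (k * t) : ℝ) : ℂ) * f t) (a := a) (b := T)
    (fun t ht => ((hF t ht.1).mono Icc_subset_Ici_self).continuousWithinAt)
    (fun t ht => (hF t ht.1).mono (Ici_subset_Ici.2 ht.1))
    (by simp [ha]) hB
    (fun t ht => by
      rw [norm_mul, Complex.norm_real, Real.norm_of_nonneg (Real.exp_pos _).le]
      have h₁ := mul_le_mul_of_nonneg_left (hg t (Ico_subset_Icc_self ht)) (Real.exp_pos (k * t)).le
      have h₂ : 0 ≤ Real.exp (-c * a) - Real.exp (-c * t) :=
        sub_nonneg.2 (Real.exp_le_exp.2 (by nlinarith [ht.1]))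
      have h₃ : 0 ≤ Real.exp (k * t) * k * (K * (Real.exp (-c * a) - Real.exp (-c * t))) := by
        positivity
      linarith)
    (right_mem_Icc.2 haT)
  rw [norm_mul, Complex.norm_real, Real.norm_of_nonneg (Real.exp_pos _).le] at key
  have h := le_of_mul_le_mul_left key (Real.exp_pos _)
  nlinarith [Real.exp_pos (-c * T)]

theorem growing_solution_close_to_exponential
    (α C c₁ : ℝ) (hα : 0 < α) (hC : 0 < C) (hc₁ : 0 < c₁)
    (q : ℝ → ℂ) (hqc : ContinuousOn q (Ici (0 : ℝ)))
    (hqb : ∀ Y ≥ (0 : ℝ), ‖q Y‖ ≤ C * Real.exp (-c₁ * Y)) :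
    ∀ δ ∈ Ioo (0 : ℝ) 1, ∃ Y₀ ≥ (0 : ℝ),
      ∀ ψ₂ ψ₂' : ℝ → ℂ,
        -- `ψ₂` solves `ψ₂'' = (α² + q)ψ₂` on `[Y₀, ∞)`
        (∀ Y ∈ Ici Y₀, HasDerivWithinAt ψ₂ (ψ₂' Y) (Ici Y₀) Y) →
        (∀ Y ∈ Ici Y₀, HasDerivWithinAt ψ₂' (((α : ℂ) ^ 2 + q Y) * ψ₂ Y) (Ici Y₀) Y) →
        -- with initial data `ψ₂(Y₀) = e^{αY₀}`, `ψ₂'(Y₀) = α e^{αY₀}`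
        ψ₂ Y₀ = (Real.exp (α * Y₀) : ℝ) →
        ψ₂' Y₀ = ((α * Real.exp (α * Y₀) : ℝ) : ℂ) →
        ∀ Y ≥ Y₀, ‖ψ₂ Y - ((Real.exp (α * Y) : ℝ) : ℂ)‖ ≤ δ * Real.exp (α * Y) := by
  intro δ hδ
  have hlim : Tendsto (fun Y : ℝ => C / c₁ * Real.exp (-c₁ * Y)) atTop (𝓝 0) := by
    simpa using (Real.tendsto_exp_atBot.comp
      (tendsto_id.const_mul_atTop_of_neg (neg_lt_zero.2 hc₁))).const_mul (C / c₁)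
  obtain ⟨Y₀, hsmall, hY₀⟩ := ((hlim.eventually_lt_const
    (by nlinarith [hδ.1] : (0 : ℝ) < α * δ / 2)).and (eventually_ge_atTop 0)).exists
  refine ⟨Y₀, hY₀, ?_⟩
  intro ψ φ hψ hφ hψ₀ hφ₀ Y hY
  set e : ℝ → ℂ := fun t => ((Real.exp (-α * t) : ℝ) : ℂ) with he
  have hed (t : ℝ) : HasDerivWithinAt e (-(α : ℂ) * e t) (Ici Y₀) t := by
    have h : HasDerivAt (fun t : ℝ => Real.exp (-α * t)) (Real.exp (-α * t) * -α) t := by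
      simpa using ((hasDerivAt_id t).const_mul (-α)).exp
    refine h.ofReal_comp.hasDerivWithinAt.congr_deriv ?_
    simp only [he]
    push_cast
    ring
  have hee (t : ℝ) : e t * ((Real.exp (α * t) : ℝ) : ℂ) = 1 := by
    simp only [he]
    rw [← Complex.ofReal_mul, ← Real.exp_add]
    simp
  have hv : ∀ t ∈ Ici Y₀, HasDerivWithinAt (fun t => e t * (φ t + α * ψ t) - 2 * α)
      (-((0 : ℝ) : ℂ) * (e t * (φ t + α * ψ t) - 2 * α) + q t * (e t * ψ t)) (Ici Y₀) t := by
    intro t ht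
    refine (((hed t).mul ((hφ t ht).add ((hψ t ht).const_mul (α : ℂ)))).sub_const
      (2 * α : ℂ)).congr_deriv ?_
    push_cast
    simp only [Pi.add_apply]
    ring
  have hw : ∀ t ∈ Ici Y₀, HasDerivWithinAt (fun t => e t * (φ t - α * ψ t))
      (-((2 * α : ℝ) : ℂ) * (e t * (φ t - α * ψ t)) + q t * (e t * ψ t)) (Ici Y₀) t := by
    intro t ht
    refine ((hed t).mul ((hφ t ht).sub ((hψ t ht).const_mul (α : ℂ)))).congr_deriv ?_
    push_cast
    simp only [Pi.sub_apply]
    ring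
  have hcont : ContinuousOn (fun t => ‖e t * ψ t‖) (Icc Y₀ Y) := fun t ht =>
    (((hed t).mul (hψ t ht.1)).mono Icc_subset_Ici_self).continuousWithinAt.norm
  obtain ⟨m, hm, hmax⟩ := isCompact_Icc.exists_isMaxOn (nonempty_Icc.2 hY) hcont
  set M := ‖e m * ψ m‖ with hM
  have hMnonneg : 0 ≤ M := norm_nonneg _
  -- Every point of the interval is controlled by the maximum `M` of `‖e ψ‖`.
  have hbound : ∀ t ∈ Icc Y₀ Y, ‖e t * ψ t - 1‖ ≤ δ / 2 * M := by
    intro t ht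
    have hg : ∀ s ∈ Icc Y₀ t, ‖q s * (e s * ψ s)‖ ≤ C / c₁ * M * c₁ * Real.exp (-c₁ * s) := by
      intro s hs
      rw [norm_mul]
      calc ‖q s‖ * ‖e s * ψ s‖ ≤ (C * Real.exp (-c₁ * s)) * M :=
            mul_le_mul (hqb s (hY₀.trans hs.1)) (hmax ⟨hs.1, hs.2.trans ht.2⟩)
              (norm_nonneg _) (by positivity)
        _ = C / c₁ * M * c₁ * Real.exp (-c₁ * s) := by field_simp
    have hK : 0 ≤ C / c₁ * M := by positivity
    have h₁ := norm_le_of_hasDerivWithinAt_damped le_rfl hK hc₁ ht.1 hv hg (by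
      rw [hψ₀, hφ₀]
      push_cast
      have := hee Y₀
      push_cast at this
      linear_combination (2 * α : ℂ) * this)
    have h₂ := norm_le_of_hasDerivWithinAt_damped (by positivity) hK hc₁ ht.1 hw hg (by
      rw [hψ₀, hφ₀]
      push_cast
      ring)
    have h₃ : ((2 * α : ℝ) : ℂ) * (e t * ψ t - 1) =
        (e t * (φ t + α * ψ t) - 2 * α) - e t * (φ t - α * ψ t) := by
      push_cast
      ring
    have h₄ := norm_sub_le (e t * (φ t + α * ψ t) - 2 * α) (e t * (φ t - α * ψ t))
    rw [← h₃, norm_mul, Complex.norm_real, Real.norm_of_nonneg (by positivity)] at h₄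
    have h₅ := mul_le_mul_of_nonneg_right hsmall.le hMnonneg
    have h₆ : α * ‖e t * ψ t - 1‖ ≤ α * (δ / 2 * M) := by linarith
    exact le_of_mul_le_mul_left h₆ hα
  have hM2 : M ≤ 2 := by
    have h₁ := hbound m hm
    have h₂ := norm_le_norm_add_norm_sub' (e m * ψ m) 1
    rw [norm_one] at h₂
    nlinarith [hδ.2]
  have hclose : ‖e Y * ψ Y - 1‖ ≤ δ :=
    (hbound Y (right_mem_Icc.2 hY)).trans (by nlinarith [hδ.1])
  have hfactor : ψ Y - ((Real.exp (α * Y) : ℝ) : ℂ) =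
      (e Y * ψ Y - 1) * ((Real.exp (α * Y) : ℝ) : ℂ) := by
    linear_combination (-ψ Y) * hee Y
  rw [hfactor, norm_mul, Complex.norm_real, Real.norm_of_nonneg (Real.exp_pos _).le]
  exact mul_le_mul_of_nonneg_right hclose (Real.exp_pos _).le
end
end
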